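/- arXiv:1710.04217 — 2 statements merged into one kernel-verified Lean document; each statement's English description precedes it below -/
import Mathlib

section
/- Let Y be a Polish space and 𝒴 ⊆ Y a Borel subset with the trace σ-algebra, and let λ denote Lebesgue measure. Suppose given n(k) ∈ ℕ for each k ∈ ℕ and, for every k and every n ≥ n(k), a jointly measurable map S_{n,k} : 𝒴 × [0,1]^k → X_k such that for every y ∈ 𝒴, every k, and every n ≥ max(n(k), n(k+1)), the coherence condition r_k(S_{n,k+1}(y, u_1,…,u_{k+1})) = S_{n,k}(y, u_1,…,u_k) holds for λ^{k+1}-almost all (u_1,…,u_{k+1}) ∈ [0,1]^{k+1}. Assume that for every y ∈ 𝒴, every k, and every a ∈ X_k the limit t_a(y) := lim_{n→∞} λ^k{u ∈ [0,1]^k : S_{n,k}(y,u) = a} exists, and that Σ_{a∈X_k} t_a(y) = 1 for every k. Then there exists a jointly measurable map S_∞ : 𝒴 × [0,1] → X such that for every y ∈ 𝒴, every k, and every a ∈ X_k, λ^k{u ∈ [0,1]^k : S_{n,k}(y,u) = a} → λ{u ∈ [0,1] : (S_∞(y,u))|_k = a} as n → ∞; that is, the samples of size k converge in distribution to the k-prefix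 of the limiting sampler. -/
open MeasureTheory Filter Topology
open scoped ENNReal

/-- The space of coherent sequences (inverse limit) of the system `r n : X (n+1) → X n`. -/
abbrev Coherent (X : ℕ → Type*) (r : ∀ n, X (n + 1) → X n) : Type _ :=
  {x : ∀ n, X n // ∀ n, r n (x (n + 1)) = x n}

/-- The mass of `f` on the points that precede `a` in the enumeration `e`. -/
noncomputable def massBelow {α : Type*} (e : α → ℕ) (f : α → ℝ≥0∞) (a : α) : ℝ≥0∞ :=
  ∑' b, {b | e b < e a}.indicator f b

section massBelow

variable {α : Type*} {e : α → ℕ} {f : α → ℝ≥0∞}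

lemma tsum_indicator_lt_succ (he : e.Injective) (a : α) :
    ∑' b, {b | e b < e a + 1}.indicator f b = massBelow e f a + f a := by
  have h : {b | e b < e a + 1} = {b | e b < e a} ∪ {a} := by
    ext b
    simp only [Set.mem_ofPred_eq, Set.mem_union, Set.mem_singleton_iff, Nat.lt_succ_iff_lt_or_eq,
      he.eq_iff]
  have hd : Disjoint {b | e b < e a} {a} := by simp
  rw [h, Set.indicator_union_of_disjoint hd]
  simp only [ENNReal.tsum_add, massBelow]
  congr 1
  rw [← tsum_subtype, tsum_singleton]

lemma massBelow_add_le_tsum (he : e.Injective) (a : α) :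
    massBelow e f a + f a ≤ ∑' b, f b := by
  rw [← tsum_indicator_lt_succ he]
  exact ENNReal.tsum_le_tsum fun b => Set.indicator_le_self _ _ _

lemma massBelow_add_le_massBelow (he : e.Injective) {a b : α} (hab : e a < e b) :
    massBelow e f a + f a ≤ massBelow e f b := by
  rw [← tsum_indicator_lt_succ he]
  refine ENNReal.tsum_le_tsum fun c => ?_
  refine Set.indicator_le_indicator_of_subset (fun c hc => ?_) (fun _ => zero_le) c
  simp only [Set.mem_ofPred_eq] at hc ⊢
  omega

/-- The intervals `[c + massBelow a, c + massBelow a + f a)` cover `[c, c + ∑ f)`. -/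
lemma exists_mem_Ico_massBelow (he : e.Injective) {c u : ℝ≥0∞}
    (hu : u ∈ Set.Ico c (c + ∑' b, f b)) :
    ∃ a, u ∈ Set.Ico (c + massBelow e f a) (c + massBelow e f a + f a) := by
  classical
  have hex : ∃ n : ℕ, u < c + ∑' b, {b | e b < n}.indicator f b := by
    rw [ENNReal.tsum_eq_iSup_sum, ENNReal.add_iSup, Set.mem_Ico, lt_iSup_iff] at hu
    obtain ⟨s, hs⟩ := hu.2
    refine ⟨s.sup e + 1, hs.trans_le ?_⟩
    gcongr
    refine le_trans (Finset.sum_le_sum fun b hb => ?_) (ENNReal.sum_le_tsum s)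
    rw [Set.indicator_of_mem]
    exact Nat.lt_succ_of_le (Finset.le_sup hb)
  have hlt := Nat.find_spec hex
  have hmin := fun m => Nat.find_min (H := hex) (m := m)
  generalize Nat.find hex = n at hlt hmin
  cases n with
  | zero =>
    simp only [not_lt_zero, Set.ofPred_false, Set.indicator_empty, tsum_zero, add_zero] at hlt
    exact absurd hu.1 hlt.not_ge
  | succ m =>
    have hm := not_lt.1 (hmin m m.lt_succ_self)
    obtain ⟨a, rfl⟩ : ∃ a, e a = m := by
      by_contra! h
      have hset : {b | e b < m + 1} = {b | e b < m} := by
        ext b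
        have := h b
        simp only [Set.mem_ofPred_eq]
        omega
      rw [hset] at hlt
      exact hm.not_gt hlt
    rw [tsum_indicator_lt_succ he, ← add_assoc] at hlt
    exact ⟨a, hm, hlt⟩

lemma eq_of_mem_Ico_massBelow (he : e.Injective) {c u : ℝ≥0∞} {a b : α}
    (ha : u ∈ Set.Ico (c + massBelow e f a) (c + massBelow e f a + f a))
    (hb : u ∈ Set.Ico (c + massBelow e f b) (c + massBelow e f b + f b)) : a = b := by
  have key : ∀ {a b : α}, u ∈ Set.Ico (c + massBelow e f a) (c + massBelow e f a + f a) →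
      u ∈ Set.Ico (c + massBelow e f b) (c + massBelow e f b + f b) → ¬ e a < e b := by
    intro a b ha hb hab
    have h := add_le_add_right (massBelow_add_le_massBelow (f := f) he hab) c
    rw [← add_assoc] at h
    exact absurd (ha.2.trans_le (h.trans hb.1)) (lt_irrefl _)
  exact he (le_antisymm (not_lt.1 (key hb ha)) (not_lt.1 (key ha hb)))

end massBelow

/-- The left endpoint of the interval assigned to `a : X k` when `[0, 1)` is cut successively into
intervals of lengths `t k a`, those of the successors of `a` subdividing that of `a`. -/
noncomputable def leftEndpoint {X : ℕ → Type*} (r : ∀ n, X (n + 1) → X n) (e : ∀ n, X n → ℕ)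
    (t : ∀ n, X n → ℝ≥0∞) : ∀ k, X k → ℝ≥0∞
  | 0, a => massBelow (e 0) (t 0) a
  | k + 1, b => leftEndpoint r e t k (r k b) +
      massBelow (e (k + 1)) ((r k ⁻¹' {r k b}).indicator (t (k + 1))) b

/-- The interval assigned to `a : X k` in the successive subdivision of `[0, 1)`. -/
def prefixInterval {X : ℕ → Type*} (r : ∀ n, X (n + 1) → X n) (e : ∀ n, X n → ℕ)
    (t : ∀ n, X n → ℝ≥0∞) (k : ℕ) (a : X k) : Set ℝ≥0∞ :=
  Set.Ico (leftEndpoint r e t k a) (leftEndpoint r e t k a + t k a)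

section prefixInterval

variable {X : ℕ → Type*} {r : ∀ n, X (n + 1) → X n} {e : ∀ n, X n → ℕ} {t : ∀ n, X n → ℝ≥0∞}

lemma leftEndpoint_succ_add_le (he : ∀ n, (e n).Injective)
    (hcons : ∀ k a, ∑' b, (r k ⁻¹' {a}).indicator (t (k + 1)) b = t k a) (k : ℕ) (b : X (k + 1)) :
    leftEndpoint r e t (k + 1) b + t (k + 1) b ≤
      leftEndpoint r e t k (r k b) + t k (r k b) := by
  have h := massBelow_add_le_tsum (f := (r k ⁻¹' {r k b}).indicator (t (k + 1))) (he (k + 1)) b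
  rw [hcons, Set.indicator_of_mem (by simp)] at h
  rw [leftEndpoint, add_assoc]
  gcongr

lemma leftEndpoint_add_le_one (he : ∀ n, (e n).Injective) (hone : ∑' a, t 0 a = 1)
    (hcons : ∀ k a, ∑' b, (r k ⁻¹' {a}).indicator (t (k + 1)) b = t k a) (k : ℕ) (a : X k) :
    leftEndpoint r e t k a + t k a ≤ 1 := by
  induction k with
  | zero => exact hone ▸ massBelow_add_le_tsum (he 0) a
  | succ k ih => exact (leftEndpoint_succ_add_le he hcons k a).trans (ih _)

lemma prefixInterval_succ_subset (he : ∀ n, (e n).Injective)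
    (hcons : ∀ k a, ∑' b, (r k ⁻¹' {a}).indicator (t (k + 1)) b = t k a) (k : ℕ) (b : X (k + 1)) :
    prefixInterval r e t (k + 1) b ⊆ prefixInterval r e t k (r k b) :=
  Set.Ico_subset_Ico (by rw [leftEndpoint]; exact le_self_add)
    (leftEndpoint_succ_add_le he hcons k b)

lemma eq_of_mem_prefixInterval (he : ∀ n, (e n).Injective)
    (hcons : ∀ k a, ∑' b, (r k ⁻¹' {a}).indicator (t (k + 1)) b = t k a) {k : ℕ} {a b : X k}
    {u : ℝ≥0∞} (ha : u ∈ prefixInterval r e t k a) (hb : u ∈ prefixInterval r e t k b) :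
    a = b := by
  induction k with
  | zero =>
    refine eq_of_mem_Ico_massBelow (c := 0) (f := t 0) (he 0) (u := u) ?_ ?_
    · simpa [prefixInterval, leftEndpoint] using ha
    · simpa [prefixInterval, leftEndpoint] using hb
  | succ k ih =>
    have hab : r k a = r k b := ih (prefixInterval_succ_subset he hcons k a ha)
      (prefixInterval_succ_subset he hcons k b hb)
    refine eq_of_mem_Ico_massBelow (c := leftEndpoint r e t k (r k b))
      (f := (r k ⁻¹' {r k b}).indicator (t (k + 1))) (he (k + 1)) (u := u) ?_ ?_
    · rw [Set.indicator_of_mem (a := a) (by simpa using hab)]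
      simpa only [prefixInterval, leftEndpoint, hab] using ha
    · rw [Set.indicator_of_mem (a := b) (by simp)]
      exact hb

lemma exists_mem_prefixInterval (he : ∀ n, (e n).Injective) (hone : ∑' a, t 0 a = 1)
    (hcons : ∀ k a, ∑' b, (r k ⁻¹' {a}).indicator (t (k + 1)) b = t k a) (k : ℕ)
    {u : ℝ≥0∞} (hu : u < 1) : ∃ a, u ∈ prefixInterval r e t k a := by
  induction k with
  | zero =>
    have h := exists_mem_Ico_massBelow (c := 0) (u := u) (f := t 0) (he 0) (by simpa [hone])
    simpa [prefixInterval, leftEndpoint] using h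
  | succ k ih =>
    obtain ⟨a, ha⟩ := ih
    rw [prefixInterval, ← hcons k a] at ha
    obtain ⟨b, hb⟩ := exists_mem_Ico_massBelow (he (k + 1)) ha
    have hba : b ∈ r k ⁻¹' {a} := by
      by_contra h
      rw [Set.indicator_of_notMem h] at hb
      simp at hb
    rw [Set.indicator_of_mem hba] at hb
    obtain rfl : r k b = a := hba
    exact ⟨b, hb⟩

/-- Every point of `[0, 1)` selects a coherent sequence of nested intervals. -/
lemma exists_coherent_mem_prefixInterval (he : ∀ n, (e n).Injective) (hone : ∑' a, t 0 a = 1)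
    (hcons : ∀ k a, ∑' b, (r k ⁻¹' {a}).indicator (t (k + 1)) b = t k a)
    {u : ℝ≥0∞} (hu : u < 1) : ∃ x : Coherent X r, ∀ k, u ∈ prefixInterval r e t k (x.1 k) := by
  choose x hx using fun k => exists_mem_prefixInterval he hone hcons k hu
  exact ⟨⟨x, fun k => eq_of_mem_prefixInterval he hcons
    (prefixInterval_succ_subset he hcons k _ (hx (k + 1))) (hx k)⟩, hx⟩

end prefixInterval

lemma measurable_leftEndpoint {Ω : Type*} [MeasurableSpace Ω] {X : ℕ → Type*}
    [∀ n, Countable (X n)] (r : ∀ n, X (n + 1) → X n) (e : ∀ n, X n → ℕ)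
    {t : Ω → ∀ n, X n → ℝ≥0∞} (ht : ∀ k a, Measurable fun y => t y k a) (k : ℕ) (a : X k) :
    Measurable fun y => leftEndpoint r e (t y) k a := by
  classical
  induction k with
  | zero =>
    simp only [leftEndpoint, massBelow, Set.indicator_apply]
    refine Measurable.tsum fun b => ?_
    split_ifs
    · exact ht 0 b
    · exact measurable_const
  | succ k ih =>
    simp only [leftEndpoint, massBelow, Set.indicator_apply]
    refine (ih _).add (Measurable.tsum fun b => ?_)
    split_ifs
    · exact ht (k + 1) b
    all_goals exact measurable_const

lemma nonempty_coherent {X : ℕ → Type*} [Nonempty (X 0)] {r : ∀ n, X (n + 1) → X n}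
    (hr : ∀ n, Function.Surjective (r n)) : Nonempty (Coherent X r) :=
  ⟨⟨fun n => Nat.rec (Classical.arbitrary (X 0)) (fun n a => Function.surjInv (hr n) a) n,
    fun n => Function.surjInv_eq (hr n) _⟩⟩

lemma unitInterval.volume_ofReal_mem_Ico {a b : ℝ≥0∞} (hab : a ≤ b) (hb : b ≤ 1) :
    volume {u : unitInterval | ENNReal.ofReal u ∈ Set.Ico a b} = b - a := by
  have hbt : b ≠ ∞ := ne_top_of_le_ne_top ENNReal.one_ne_top hb
  have hat : a ≠ ∞ := ne_top_of_le_ne_top hbt hab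
  have hmem : ∀ {c : ℝ≥0∞}, c ≤ 1 → c.toReal ∈ unitInterval := fun hc =>
    ⟨ENNReal.toReal_nonneg, ENNReal.toReal_mono ENNReal.one_ne_top hc⟩
  have h : {u : unitInterval | ENNReal.ofReal u ∈ Set.Ico a b} =
      Set.Ico ⟨a.toReal, hmem (hab.trans hb)⟩ ⟨b.toReal, hmem hb⟩ := by
    ext u
    simp only [Set.mem_ofPred_eq, Set.mem_Ico, ← Subtype.coe_le_coe, ← Subtype.coe_lt_coe,
      ENNReal.le_ofReal_iff_toReal_le hat u.2.1, ENNReal.ofReal_lt_iff_lt_toReal u.2.1 hbt]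
  rw [h, unitInterval.volume_Ico]
  simp only
  rw [ENNReal.ofReal_sub _ ENNReal.toReal_nonneg, ENNReal.ofReal_toReal hat,
    ENNReal.ofReal_toReal hbt]

/-- A measurable family of consistent prefix densities is realized by a sampler. -/
lemma exists_measurable_sampler {Ω : Type*} [MeasurableSpace Ω] {X : ℕ → Type*}
    [∀ n, Countable (X n)] [Nonempty (X 0)]
    [∀ n, MeasurableSpace (X n)] {r : ∀ n, X (n + 1) → X n}
    (hr : ∀ n, Function.Surjective (r n)) {t : Ω → ∀ n, X n → ℝ≥0∞}
    (ht : ∀ k a, Measurable fun y => t y k a) (hone : ∀ y, ∑' a, t y 0 a = 1)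
    (hcons : ∀ y k a, ∑' b, (r k ⁻¹' {a}).indicator (t y (k + 1)) b = t y k a) :
    ∃ F : Ω × unitInterval → Coherent X r, Measurable F ∧
      ∀ y k a, volume {u : unitInterval | (F (y, u)).1 k = a} = t y k a := by
  choose e he using fun n => exists_injective_nat (X n)
  obtain ⟨x₀⟩ := nonempty_coherent hr
  have hex : ∀ p : Ω × unitInterval, ∃ x : Coherent X r,
      (p.2 < 1 → ∀ k, ENNReal.ofReal p.2 ∈ prefixInterval r e (t p.1) k (x.1 k)) ∧
      (¬ p.2 < 1 → x = x₀) := by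
    intro p
    by_cases hp : p.2 < 1
    · have hp' : ENNReal.ofReal p.2 < 1 := ENNReal.ofReal_lt_one.2 hp
      obtain ⟨x, hx⟩ := exists_coherent_mem_prefixInterval he (hone p.1) (hcons p.1) hp'
      exact ⟨x, fun _ => hx, fun h => absurd hp h⟩
    · exact ⟨x₀, fun h => absurd h hp, fun _ => rfl⟩
  choose F hF hF₀ using hex
  have hiff : ∀ p : Ω × unitInterval, p.2 < 1 → ∀ k a,
      ((F p).1 k = a ↔ ENNReal.ofReal p.2 ∈ prefixInterval r e (t p.1) k a) := by
    refine fun p hp k a => ⟨?_, fun h => eq_of_mem_prefixInterval he (hcons p.1) (hF p hp k) h⟩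
    rintro rfl
    exact hF p hp k
  refine ⟨F, ?_, fun y k a => ?_⟩
  · refine (measurable_pi_iff.2 fun k => measurable_to_countable' fun a => ?_).subtype_mk
    have hset : (fun p => (F p).1 k) ⁻¹' {a} =
        ({p | p.2 < 1} ∩ {p | ENNReal.ofReal p.2 ∈ prefixInterval r e (t p.1) k a}) ∪
        ({p | ¬ p.2 < 1} ∩ {_p | x₀.1 k = a}) := by
      ext p
      by_cases hp : p.2 < 1
      · simp [hp, hiff p hp]
      · simp only [Set.mem_preimage, Set.mem_singleton_iff, Set.mem_union, Set.mem_inter_iff,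
          Set.mem_ofPred_eq, hp, hF₀ p hp, false_and, false_or, not_false_eq_true, true_and]
    have hlt : MeasurableSet {p : Ω × unitInterval | p.2 < 1} :=
      measurableSet_lt measurable_snd measurable_const
    have hL : Measurable fun p : Ω × unitInterval => leftEndpoint r e (t p.1) k a :=
      (measurable_leftEndpoint r e ht k a).comp measurable_fst
    have hR : Measurable fun p : Ω × unitInterval => leftEndpoint r e (t p.1) k a + t p.1 k a :=
      hL.add ((ht k a).comp measurable_fst)
    have hu : Measurable fun p : Ω × unitInterval => ENNReal.ofReal p.2 :=
      (measurable_subtype_coe.comp measurable_snd).ennreal_ofReal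
    rw [hset]
    exact (hlt.inter ((measurableSet_le hL hu).inter (measurableSet_lt hu hR))).union
      (hlt.compl.inter (MeasurableSet.const _))
  · have hle := leftEndpoint_add_le_one he (hone y) (hcons y) k a
    have hae : {u : unitInterval | (F (y, u)).1 k = a} =ᵐ[volume]
        {u : unitInterval | ENNReal.ofReal u ∈ prefixInterval r e (t y) k a} := by
      have h1 : ∀ᵐ u : unitInterval, u ≠ 1 := by simp [ae_iff]
      filter_upwards [h1] with u hu
      exact propext (hiff (y, u) (unitInterval.lt_one_iff_ne_one.2 hu) k a)
    rw [measure_congr hae]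
    refine (unitInterval.volume_ofReal_mem_Ico le_self_add hle).trans ?_
    exact ENNReal.add_sub_cancel_left
      (ne_top_of_le_ne_top ENNReal.one_ne_top (le_self_add.trans hle))

lemma measurePreserving_comp_castSucc (k : ℕ) {α : Type*} [MeasureSpace α]
    [IsProbabilityMeasure (volume : Measure α)] :
    MeasurePreserving (fun (u : Fin (k + 1) → α) (i : Fin k) => u i.castSucc) := by
  have h := (measurePreserving_snd (μ := (volume : Measure α))
    (ν := (volume : Measure (Fin k → α)))).comp
    (volume_preserving_piFinSuccAbove (fun _ => α) (Fin.last k))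
  have heq : (fun (u : Fin (k + 1) → α) (i : Fin k) => u i.castSucc) =
      Prod.snd ∘ MeasurableEquiv.piFinSuccAbove (fun _ => α) (Fin.last k) := by
    funext u i
    simp [MeasurableEquiv.piFinSuccAbove, Fin.init]
  exact heq ▸ h

lemma eq_of_le_of_tsum_le {α : Type*} {f g : α → ℝ≥0∞} (hfg : f ≤ g) (hf : ∑' a, f a ≠ ∞)
    (hgf : ∑' a, g a ≤ ∑' a, f a) : f = g := by
  by_contra hne
  obtain ⟨a, ha⟩ := Function.ne_iff.1 hne
  exact (ENNReal.tsum_lt_tsum hf hfg (lt_of_le_of_ne (hfg a) ha)).not_ge hgf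

lemma tsum_tsum_fiber_indicator {α β : Type*} (f : β → ℝ≥0∞) (g : β → α) :
    ∑' a, ∑' b, (g ⁻¹' {a}).indicator f b = ∑' b, f b := by
  simp only [← tsum_subtype]
  exact ENNReal.tsum_fiberwise f g

/-- **Existence of the limiting sampler** (Theorem: limit of a sampling algorithm in input size).
Given a sampling algorithm `S n k : 𝒴 × [0,1]^k → X k` whose prefix densities
`t y k a = lim_n λ^k{u : S n k (y,u) = a}` exist and sum to one, there is a jointly
measurable limiting sampler `Sinf : 𝒴 × [0,1] → X` whose size-`k` prefix is the
distributional limit of `S n k` as `n → ∞`. -/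
theorem limiting_sampler_exists
    (Y : Type*) [TopologicalSpace Y] [PolishSpace Y] [MeasurableSpace Y] [BorelSpace Y]
    (𝒴 : Set Y) (h𝒴 : MeasurableSet 𝒴)
    (X : ℕ → Type*) [∀ n, Countable (X n)] [∀ n, Nonempty (X n)]
    [∀ n, MeasurableSpace (X n)] [∀ n, DiscreteMeasurableSpace (X n)]
    (r : ∀ n, X (n + 1) → X n) (hr : ∀ n, Function.Surjective (r n))
    (n₀ : ℕ → ℕ)
    (S : ℕ → (k : ℕ) → 𝒴 × (Fin k → unitInterval) → X k)
    (hSmeas : ∀ k, ∀ n, n₀ k ≤ n → Measurable (S n k))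
    (hcoh : ∀ (y : 𝒴) (k : ℕ), ∀ n, max (n₀ k) (n₀ (k + 1)) ≤ n →
      ∀ᵐ u ∂(volume : Measure (Fin (k + 1) → unitInterval)),
        r k (S n (k + 1) (y, u)) = S n k (y, fun i => u i.castSucc))
    (t : 𝒴 → (k : ℕ) → X k → ℝ≥0∞)
    (hlim : ∀ (y : 𝒴) (k : ℕ) (a : X k),
      Tendsto (fun n => volume {u : Fin k → unitInterval | S n k (y, u) = a})
        atTop (𝓝 (t y k a)))
    (hsum : ∀ (y : 𝒴) (k : ℕ), ∑' a : X k, t y k a = 1) :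
    ∃ Sinf : 𝒴 × unitInterval → Coherent X r,
      Measurable Sinf ∧
      ∀ (y : 𝒴) (k : ℕ) (a : X k),
        Tendsto (fun n => volume {u : Fin k → unitInterval | S n k (y, u) = a})
          atTop (𝓝 (volume {u : unitInterval | (Sinf (y, u)).1 k = a})) := by
  have ht : ∀ k a, Measurable fun y => t y k a := by
    intro k a
    refine measurable_of_tendsto_metrizable
      (f := fun n y => volume {u : Fin k → unitInterval | S (n + n₀ k) k (y, u) = a})
      (fun n => ?_) (tendsto_pi_nhds.2 fun y =>
        (tendsto_add_atTop_iff_nat (n₀ k)).2 (hlim y k a))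
    exact measurable_measure_prodMk_left
      (hSmeas k _ (Nat.le_add_left _ _) (measurableSet_singleton a))
  have hle : ∀ y k, (fun a => ∑' b, (r k ⁻¹' {a}).indicator (t y (k + 1)) b) ≤ t y k := by
    intro y k a
    classical
    refine (ENNReal.tsum_eq_iSup_sum).trans_le (iSup_le fun s => ?_)
    simp only [Set.indicator_apply, ← Finset.sum_filter, Set.mem_preimage,
      Set.mem_singleton_iff]
    refine le_of_tendsto_of_tendsto (tendsto_finsetSum _ fun b _ => hlim y (k + 1) b)
      (hlim y k a) ?_
    filter_upwards [eventually_ge_atTop (max (n₀ k) (n₀ (k + 1)))] with n hn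
    have hm : ∀ j, n₀ j ≤ n → Measurable fun u => S n j (y, u) := fun j hj =>
      (hSmeas j n hj).comp measurable_prodMk_left
    have hmk := hm k (le_of_max_le_left hn)
    have hmk' := hm (k + 1) (le_of_max_le_right hn)
    have hpre : volume {u : Fin (k + 1) → unitInterval |
        S n k (y, fun i => u i.castSucc) = a} = volume {u | S n k (y, u) = a} :=
      (measurePreserving_comp_castSucc k).measure_preimage
        (hmk (measurableSet_singleton a)).nullMeasurableSet
    rw [← hpre, ← measure_biUnion_finset]
    · refine measure_mono_ae ?_
      filter_upwards [hcoh y k n hn] with u hu h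
      obtain ⟨b, hb, rfl⟩ := Set.mem_iUnion₂.1 h
      exact hu.symm.trans (Finset.mem_filter.1 hb).2
    · intro b _ c _ hbc
      exact Set.disjoint_left.2 fun u hb hc => hbc (hb.symm.trans hc)
    · exact fun b _ => hmk' (measurableSet_singleton b)
  have hcons : ∀ y k a, ∑' b, (r k ⁻¹' {a}).indicator (t y (k + 1)) b = t y k a := by
    intro y k a
    refine congrFun (eq_of_le_of_tsum_le (hle y k) ?_ ?_) a
    · rw [tsum_tsum_fiber_indicator, hsum]
      exact ENNReal.one_ne_top
    · rw [tsum_tsum_fiber_indicator, hsum, hsum]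
  obtain ⟨F, hF, hvol⟩ := exists_measurable_sampler hr ht (fun y => hsum y 0) hcons
  refine ⟨F, hF, fun y k a => ?_⟩
  rw [hvol]
  exact hlim y k a
end

section
/- There exists a Borel measurable map ξ : 𝐗 → P(𝐗), where P(𝐗) is the space of Borel probability measures on 𝐗 with the topology of weak convergence, such that (a) for every Borel set A ⊆ 𝐗 the function x ↦ ξ(x)(A) is a version of the conditional probability μ[A | 𝔍], and (b) for μ-almost every x ∈ 𝐗 the empirical measures (1/k!) Σ_{π ∈ S_k} δ_{T_π x} converge weakly to ξ(x) as k → ∞. -/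
open MeasureTheory Filter Topology BoundedContinuousFunction

/-- A permutation of `ℕ` is finitely supported if it moves only finitely many points. -/
def FinitelySupported (π : Equiv.Perm ℕ) : Prop := {n : ℕ | π n ≠ n}.Finite

/-- The σ-algebra of Borel sets invariant under `T φ` for every `φ` in the set `S`. -/
def invSigmaOn {G X : Type*} [MeasurableSpace X] (S : Set G) (T : G → X → X) :
    MeasurableSpace X where
  MeasurableSet' A := MeasurableSet A ∧ ∀ φ ∈ S, T φ ⁻¹' A = A
  measurableSet_empty := ⟨MeasurableSet.empty, fun _ _ => Set.preimage_empty⟩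
  measurableSet_compl A hA := ⟨hA.1.compl, fun φ hφ => by
    rw [Set.preimage_compl, hA.2 φ hφ]⟩
  measurableSet_iUnion s hs := ⟨MeasurableSet.iUnion fun i => (hs i).1, fun φ hφ => by
    rw [Set.preimage_iUnion]
    exact Set.iUnion_congr fun i => (hs i).2 φ hφ⟩

/-- The embedding of a permutation of `{0,…,k-1}` into the finitely supported
permutations of `ℕ`. -/
noncomputable def embedPerm (k : ℕ) (π : Equiv.Perm (Fin k)) : Equiv.Perm ℕ :=
  π.extendDomain Fin.equivSubtype


section ReverseMartingale

variable {Ω : Type*} {m0 : MeasurableSpace Ω} {μ : Measure Ω} {m : ℕ → MeasurableSpace Ω}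

/-- The **Doob maximal inequality** for the reverse martingale of conditional expectations along a
decreasing sequence of σ-algebras. -/
lemma measure_exists_le_abs_condExp_le [IsFiniteMeasure μ] (hm : Antitone m)
    (hle : ∀ n, m n ≤ m0) (f : Ω → ℝ) (ε : NNReal) (K : ℕ) :
    ε * μ {x | ∃ k ≤ K, (ε : ℝ) ≤ |μ[f | m k] x|} ≤ ENNReal.ofReal (∫ x, |f x| ∂μ) := by
  let ℱ : Filtration ℕ m0 :=
    ⟨fun j => m (K - j), fun i j hij => hm (by omega), fun j => hle _⟩
  have hsub : Submartingale (fun j => μ[|f| | ℱ j])⁺ ℱ μ :=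
    (martingale_condExp |f| ℱ μ).submartingale.pos
  have hmax := maximal_ineq hsub (fun j x => by simp) (ε := ε) K
  have hdom : ∀ᵐ x ∂μ, ∀ k, |μ[f | m k] x| ≤ μ[|f| | m k] x :=
    ae_all_iff.2 fun k => abs_condExp_ae_le_condExp_abs f
  refine le_trans (mul_le_mul_right (measure_mono_ae ?_) _)
    (hmax.trans (ENNReal.ofReal_le_ofReal ?_))
  · filter_upwards [hdom] with x hx
    rintro ⟨k, hk, hkx⟩
    refine (Finset.le_sup'_iff _).2 ⟨K - k, Finset.mem_range.2 (by omega), ?_⟩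
    have hval : ((fun j => μ[|f| | ℱ j])⁺) (K - k) x = (μ[|f| | m k] x)⁺ := by
      change (μ[|f| | m (K - (K - k))] x)⁺ = _
      rw [Nat.sub_sub_self hk]
    rw [hval]
    exact (hkx.trans (hx k)).trans (le_posPart _)
  · have hnn : 0 ≤ᵐ[μ] μ[|f| | ℱ K] := condExp_nonneg (.of_forall fun x => abs_nonneg (f x))
    have hpos : ((fun j => μ[|f| | ℱ j])⁺) K =ᵐ[μ] μ[|f| | ℱ K] := by
      filter_upwards [hnn] with x hx
      exact posPart_eq_self.2 hx
    calc _ ≤ ∫ x, ((fun j => μ[|f| | ℱ j])⁺) K x ∂μ :=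
          setIntegral_le_integral (hsub.integrable K) (.of_forall fun x => posPart_nonneg _)
      _ = ∫ x, (μ[|f| | ℱ K]) x ∂μ := integral_congr_ae hpos
      _ = ∫ x, |f x| ∂μ := integral_condExp (ℱ.le K)

/-- Orthogonality of the increments of a reverse martingale. -/
lemma integral_sq_condExp_sub_condExp [IsFiniteMeasure μ] {m₁ m₂ : MeasurableSpace Ω}
    (h₁₂ : m₁ ≤ m₂) (h₂ : m₂ ≤ m0) {f : Ω → ℝ} (hf : MemLp f 2 μ) :
    ∫ x, (μ[f | m₂] x - μ[f | m₁] x) ^ 2 ∂μ =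
      ∫ x, μ[f | m₂] x ^ 2 ∂μ - ∫ x, μ[f | m₁] x ^ 2 ∂μ := by
  have hL₁ : MemLp (μ[f | m₁]) 2 μ := hf.condExp one_le_two
  have hL₂ : MemLp (μ[f | m₂]) 2 μ := hf.condExp one_le_two
  have hint : Integrable (μ[f | m₂] * μ[f | m₁]) μ := hL₂.integrable_mul hL₁
  have hcross : ∫ x, μ[f | m₂] x * μ[f | m₁] x ∂μ = ∫ x, μ[f | m₁] x ^ 2 ∂μ := by
    have hpull := (condExp_mul_of_stronglyMeasurable_right (μ := μ) (m := m₁)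
      stronglyMeasurable_condExp hint integrable_condExp)
    have htower := condExp_condExp_of_le (μ := μ) (f := f) h₁₂ h₂
    calc _ = ∫ x, (μ[μ[f | m₂] * μ[f | m₁] | m₁]) x ∂μ :=
          (integral_condExp (h₁₂.trans h₂)).symm
      _ = _ := integral_congr_ae (by
        filter_upwards [hpull, htower] with x hx hx'
        rw [hx, Pi.mul_apply, hx', sq])
  have hexp : ∀ x, (μ[f | m₂] x - μ[f | m₁] x) ^ 2 =
      μ[f | m₂] x ^ 2 - 2 * (μ[f | m₂] x * μ[f | m₁] x) + μ[f | m₁] x ^ 2 := fun x => by ring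
  simp_rw [hexp]
  have hint' : Integrable (fun x => 2 * (μ[f | m₂] x * μ[f | m₁] x)) μ := hint.const_mul 2
  rw [integral_add (f := fun x => μ[f | m₂] x ^ 2 - 2 * (μ[f | m₂] x * μ[f | m₁] x))
    (hL₂.integrable_sq.sub hint') hL₁.integrable_sq,
    integral_sub hL₂.integrable_sq hint', integral_const_mul, hcross]
  ring

/-- Along a decreasing sequence of σ-algebras, the conditional expectations of a square-integrable
function are Cauchy in `L¹`. -/
lemma exists_forall_integral_abs_condExp_sub_condExp_le [IsProbabilityMeasure μ] (hm : Antitone m)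
    (hle : ∀ n, m n ≤ m0) {f : Ω → ℝ} (hf : MemLp f 2 μ) {δ : ℝ} (hδ : 0 < δ) :
    ∃ N, ∀ K ≥ N, ∫ x, |μ[f | m N] x - μ[f | m K] x| ∂μ ≤ δ := by
  have hL : ∀ n, MemLp (μ[f | m n]) 2 μ := fun n => hf.condExp one_le_two
  have hanti : Antitone fun n => ∫ x, μ[f | m n] x ^ 2 ∂μ := fun i j hij => by
    have h := integral_sq_condExp_sub_condExp (hm hij) (hle i) hf
    have h' : 0 ≤ ∫ x, (μ[f | m i] x - μ[f | m j] x) ^ 2 ∂μ :=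
      integral_nonneg fun x => sq_nonneg _
    dsimp only
    linarith
  have hbdd : BddBelow (Set.range fun n => ∫ x, μ[f | m n] x ^ 2 ∂μ) :=
    ⟨0, by rintro _ ⟨n, rfl⟩; exact integral_nonneg fun x => sq_nonneg _⟩
  obtain ⟨N, hN⟩ := Metric.cauchySeq_iff'.1 (tendsto_atTop_ciInf hanti hbdd).cauchySeq
    ((δ / 2) ^ 2) (by positivity)
  refine ⟨N, fun K hK => ?_⟩
  have hsq : ∫ x, (μ[f | m N] x - μ[f | m K] x) ^ 2 ∂μ ≤ (δ / 2) ^ 2 := by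
    rw [integral_sq_condExp_sub_condExp (hm hK) (hle N) hf]
    have := hN K hK
    rw [Real.dist_eq, abs_sub_comm] at this
    exact (le_abs_self _).trans this.le
  have hint : Integrable (fun x => (μ[f | m N] x - μ[f | m K] x) ^ 2) μ :=
    ((hL N).sub (hL K)).integrable_sq
  calc ∫ x, |μ[f | m N] x - μ[f | m K] x| ∂μ
      ≤ ∫ x, (δ / 2 + (2 / δ) * (μ[f | m N] x - μ[f | m K] x) ^ 2) ∂μ := by
        refine integral_mono (integrable_condExp.sub integrable_condExp).abs
          ((integrable_const _).add (hint.const_mul _)) fun x => ?_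
        set t := μ[f | m N] x - μ[f | m K] x
        have key : 0 ≤ (2 / δ) * (|t| - δ / 4) ^ 2 := by positivity
        have hexp : (2 / δ) * (|t| - δ / 4) ^ 2 = (2 / δ) * t ^ 2 - |t| + δ / 8 := by
          rw [← sq_abs t]
          field_simp
          ring
        dsimp only
        linarith
    _ = δ / 2 + (2 / δ) * ∫ x, (μ[f | m N] x - μ[f | m K] x) ^ 2 ∂μ := by
        rw [integral_add (integrable_const _) (hint.const_mul _), integral_const_mul]
        simp
    _ ≤ δ / 2 + (2 / δ) * (δ / 2) ^ 2 := by gcongr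
    _ = δ := by field_simp; ring

lemma measure_forall_exists_le_abs_condExp_sub_eq_zero [IsProbabilityMeasure μ] (hm : Antitone m)
    (hle : ∀ n, m n ≤ m0) {f : Ω → ℝ} (hf : MemLp f 2 μ) {ε : NNReal} (hε : 0 < ε) :
    μ {x | ∀ N, ∃ k ≥ N, 2 * (ε : ℝ) ≤ |μ[f | m k] x - μ[f | m N] x|} = 0 := by
  refine le_antisymm (ENNReal.le_of_forall_pos_le_add fun η hη _ => ?_) zero_le
  rw [zero_add]
  obtain ⟨N, hN⟩ := exists_forall_integral_abs_condExp_sub_condExp_le hm hle hf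
    (δ := ε * η) (by positivity)
  have hK : ∀ K ≥ N, μ {x | ∃ k, N ≤ k ∧ k ≤ K ∧ 2 * (ε : ℝ) ≤ |μ[f | m k] x - μ[f | m N] x|}
      ≤ η := fun K hNK => by
    have hmax := measure_exists_le_abs_condExp_le (μ := μ) (m := fun n => m (N + n))
      (fun i j hij => hm (by omega)) (fun n => hle _)
      (μ[f | m N] - μ[f | m K]) ε (K - N)
    have hcond : ∀ᵐ x ∂μ, ∀ k, N ≤ k → k ≤ K →
        (μ[μ[f | m N] - μ[f | m K] | m k]) x = μ[f | m k] x - μ[f | m K] x := by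
      refine ae_all_iff.2 fun k => ?_
      by_cases hk : N ≤ k ∧ k ≤ K
      · filter_upwards [condExp_sub (μ := μ) (f := μ[f | m N]) (g := μ[f | m K])
          integrable_condExp integrable_condExp (m k),
          condExp_condExp_of_le (μ := μ) (f := f) (hm hk.1) (hle N)] with x hx hx' _ _
        rw [hx, Pi.sub_apply, hx', condExp_of_stronglyMeasurable (hle k)
          (stronglyMeasurable_condExp.mono (hm hk.2)) integrable_condExp]
      · exact .of_forall fun x h1 h2 => absurd ⟨h1, h2⟩ hk
    have hsub : μ {x | ∃ k, N ≤ k ∧ k ≤ K ∧ 2 * (ε : ℝ) ≤ |μ[f | m k] x - μ[f | m N] x|} ≤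
        μ {x | ∃ k ≤ K - N, (ε : ℝ) ≤ |(μ[μ[f | m N] - μ[f | m K] | m (N + k)]) x|} := by
      refine measure_mono_ae ?_
      filter_upwards [hcond] with x hx
      rintro ⟨k, h1, h2, h3⟩
      by_cases hbig : (ε : ℝ) ≤ |μ[f | m k] x - μ[f | m K] x|
      · refine ⟨k - N, by omega, ?_⟩
        rwa [Nat.add_sub_cancel' h1, hx k h1 h2]
      · refine ⟨0, by omega, ?_⟩
        rw [Nat.add_zero, hx N le_rfl hNK]
        have htri := abs_sub_le (μ[f | m k] x) (μ[f | m K] x) (μ[f | m N] x)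
        rw [abs_sub_comm (μ[f | m K] x)] at htri
        linarith
    have hbound := (mul_le_mul_right hsub (ε : ENNReal)).trans
      (hmax.trans (ENNReal.ofReal_le_ofReal (hN K hNK)))
    rw [ENNReal.ofReal_mul ε.coe_nonneg, ENNReal.ofReal_coe_nnreal,
      ENNReal.ofReal_coe_nnreal] at hbound
    exact (ENNReal.mul_le_mul_iff_right (by simpa using hε.ne') ENNReal.coe_ne_top).1 hbound
  calc _ ≤ μ (⋃ K, {x | ∃ k, N ≤ k ∧ k ≤ K ∧ 2 * (ε : ℝ) ≤ |μ[f | m k] x - μ[f | m N] x|}) := by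
        refine measure_mono fun x hx => ?_
        obtain ⟨k, hk, hkx⟩ := hx N
        exact Set.mem_iUnion.2 ⟨k, k, hk, le_rfl, hkx⟩
    _ = ⨆ K, μ {x | ∃ k, N ≤ k ∧ k ≤ K ∧ 2 * (ε : ℝ) ≤ |μ[f | m k] x - μ[f | m N] x|} :=
        Monotone.measure_iUnion fun i j hij x ⟨k, h1, h2, h3⟩ => ⟨k, h1, h2.trans hij, h3⟩
    _ ≤ η := iSup_le fun K => by
        refine le_trans (measure_mono ?_) (hK (max K N) (le_max_right _ _))
        rintro x ⟨k, h1, h2, h3⟩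
        exact ⟨k, h1, h2.trans (le_max_left _ _), h3⟩

/-- The **Lévy downward theorem** for bounded functions: almost sure convergence of the conditional
expectations along a decreasing sequence of σ-algebras. -/
theorem tendsto_ae_condExp_iInf [IsProbabilityMeasure μ] (hm : Antitone m)
    (hle : ∀ n, m n ≤ m0) {f : Ω → ℝ} (hf : AEStronglyMeasurable f μ) {C : ℝ}
    (hC : ∀ᵐ x ∂μ, |f x| ≤ C) :
    ∀ᵐ x ∂μ, Tendsto (fun n => μ[f | m n] x) atTop (𝓝 (μ[f | ⨅ n, m n] x)) := by
  have hinf : ⨅ n, m n ≤ m0 := (iInf_le m 0).trans (hle 0)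
  have hcauchy : ∀ᵐ x ∂μ, CauchySeq fun n => μ[f | m n] x := by
    have h : ∀ᵐ x ∂μ, ∀ j : ℕ, ¬ ∀ N, ∃ k ≥ N,
        2 * ((1 / (j + 1 : NNReal) : NNReal) : ℝ) ≤ |μ[f | m k] x - μ[f | m N] x| :=
      ae_all_iff.2 fun j => measure_eq_zero_iff_ae_notMem.1
        (measure_forall_exists_le_abs_condExp_sub_eq_zero hm hle (MemLp.of_bound hf C hC)
          (by positivity))
    filter_upwards [h] with x hx
    refine Metric.cauchySeq_iff'.2 fun ε hε => ?_
    obtain ⟨j, hj⟩ := exists_nat_one_div_lt (half_pos hε)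
    have := hx j
    push Not at this
    obtain ⟨N, hN⟩ := this
    refine ⟨N, fun k hk => (hN k hk).trans ?_⟩
    push_cast
    linarith
  set u : Ω → ℝ := fun x => limsup (fun n => μ[f | m n] x) atTop with hu
  have hlim : ∀ᵐ x ∂μ, Tendsto (fun n => μ[f | m n] x) atTop (𝓝 (u x)) := by
    filter_upwards [hcauchy] with x hx
    obtain ⟨l, hl⟩ := cauchySeq_tendsto_of_complete hx
    simpa only [hu, hl.limsup_eq] using hl
  have hbound : ∀ n, ∀ᵐ x ∂μ, |μ[f | m n] x| ≤ C := fun n => ae_bdd_abs_condExp_of_ae_bdd_abs hC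
  have hmeas : Measurable[⨅ n, m n] u := by
    intro s hs
    refine MeasurableSpace.measurableSet_iInf.2 fun j => ?_
    have hshift : u = fun x => limsup (fun n => μ[f | m (n + j)] x) atTop :=
      funext fun x => (limsup_nat_add (fun n => μ[f | m n] x) j).symm
    rw [hshift]
    exact Measurable.limsup (mδ := m j)
      (fun n => (stronglyMeasurable_condExp.mono (hm (Nat.le_add_left j n))).measurable) hs
  have hubound : ∀ᵐ x ∂μ, |u x| ≤ C := by
    filter_upwards [hlim, ae_all_iff.2 hbound] with x hx hx'
    exact le_of_tendsto hx.abs (.of_forall hx')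
  have huint : Integrable u μ :=
    .of_bound (hmeas.mono hinf le_rfl).aestronglyMeasurable C hubound
  have heq : μ[u | ⨅ n, m n] =ᵐ[μ] μ[f | ⨅ n, m n] :=
    tendsto_condExp_unique (fun n => μ[f | m n]) (fun _ => f) u f (fun n => integrable_condExp)
      (fun _ => .of_bound hf C hC) hlim (.of_forall fun x => tendsto_const_nhds)
      (fun _ => C) (integrable_const C) (fun _ => C) (integrable_const C) hbound (fun _ => hC)
      fun n => condExp_condExp_of_le (iInf_le m n) (hle n)
  rw [condExp_of_stronglyMeasurable hinf hmeas.stronglyMeasurable huint] at heq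
  filter_upwards [hlim, heq] with x hx hx'
  rwa [← hx']

end ReverseMartingale

section InvariantSigmaAlgebra

variable {G X : Type*} [MeasurableSpace X]

lemma invSigmaOn_le (S : Set G) (T : G → X → X) : invSigmaOn S T ≤ ‹MeasurableSpace X› :=
  fun _ hA => hA.1

lemma measurable_invSigmaOn {Y : Type*} [MeasurableSpace Y] {S : Set G} {T : G → X → X}
    {g : X → Y} (hg : Measurable g) (hinv : ∀ φ ∈ S, ∀ x, g (T φ x) = g x) :
    Measurable[invSigmaOn S T] g := fun s hs =>
  ⟨hg hs, fun φ hφ => by ext x; simp only [Set.mem_preimage, hinv φ hφ]⟩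

lemma invSigmaOn_anti (T : G → X → X) : Antitone fun S : Set G => invSigmaOn S T :=
  fun _ _ hS _ hA => ⟨hA.1, fun φ hφ => hA.2 φ (hS hφ)⟩

lemma iInf_invSigmaOn {ι : Type*} [Nonempty ι] (S : ι → Set G) (T : G → X → X) :
    ⨅ i, invSigmaOn (S i) T = invSigmaOn (⋃ i, S i) T := by
  refine le_antisymm (fun A hA => ?_) (le_iInf fun i => invSigmaOn_anti T (Set.subset_iUnion S i))
  rw [MeasurableSpace.measurableSet_iInf] at hA
  refine ⟨(hA (Classical.arbitrary ι)).1, fun φ hφ => ?_⟩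
  obtain ⟨i, hi⟩ := Set.mem_iUnion.1 hφ
  exact (hA i).2 φ hi

/-- The conditional expectation given the σ-algebra invariant under a finite group of
measure-preserving transformations is the average over the group. -/
lemma average_ae_eq_condExp_invSigmaOn_range {Γ : Type*} [Group Γ] [Fintype Γ] [Group G]
    {μ : Measure X} [IsFiniteMeasure μ] (φ : Γ →* G) {T : G → X → X}
    (hTmeas : ∀ γ, Measurable (T (φ γ))) (hTcomp : ∀ g g' x, T (g * g') x = T g (T g' x))
    (hTinv : ∀ γ, Measure.map (T (φ γ)) μ = μ)
    {f : X → ℝ} (hf : Measurable f) (hint : Integrable f μ) :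
    (fun x => (∑ γ, f (T (φ γ) x)) / (Fintype.card Γ : ℝ))
      =ᵐ[μ] μ[f | invSigmaOn (Set.range φ) T] := by
  have hmp : ∀ γ, MeasurePreserving (T (φ γ)) μ μ := fun γ => ⟨hTmeas γ, hTinv γ⟩
  have hint' : ∀ γ, Integrable (fun x => f (T (φ γ) x)) μ := fun γ =>
    (hmp γ).integrable_comp_of_integrable hint
  have hmeas : Measurable[invSigmaOn (Set.range φ) T]
      fun x => (∑ γ, f (T (φ γ) x)) / (Fintype.card Γ : ℝ) := by
    refine measurable_invSigmaOn
      ((Finset.measurable_sum _ fun γ _ => hf.comp (hTmeas γ)).div_const _) ?_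
    rintro _ ⟨γ, rfl⟩ x
    congr 1
    exact Fintype.sum_equiv (Equiv.mulRight γ) _ _ fun γ' => by simp [hTcomp]
  refine ae_eq_condExp_of_forall_setIntegral_eq (invSigmaOn_le _ _) hint
    (fun s _ _ => ((integrable_finsetSum _ fun γ _ => hint' γ).div_const _).integrableOn)
    (fun s hs _ => ?_) hmeas.aestronglyMeasurable
  have hset : ∀ γ, ∫ x in s, f (T (φ γ) x) ∂μ = ∫ x in s, f x ∂μ := fun γ => by
    conv_rhs => rw [← hTinv γ]
    rw [setIntegral_map hs.1 hf.aestronglyMeasurable (hTmeas γ).aemeasurable,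
      hs.2 _ (Set.mem_range_self γ)]
  rw [integral_div, integral_finsetSum _ fun γ _ => (hint' γ).integrableOn]
  simp [hset]

end InvariantSigmaAlgebra

section EmbedPerm

lemma mem_range_embedPerm {k : ℕ} {π : Equiv.Perm ℕ} :
    π ∈ Set.range (embedPerm k) ↔ ∀ n, k ≤ n → π n = n := by
  constructor
  · rintro ⟨σ, rfl⟩ n hn
    exact Equiv.Perm.extendDomain_apply_not_subtype σ _ (by omega)
  · intro h
    have hlt : ∀ n, π n < k ↔ n < k := by
      have hle : ∀ n, k ≤ π n → k ≤ n := fun n hn => by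
        rwa [← π.injective (h _ hn)]
      intro n
      refine ⟨fun hn => ?_, fun hn => ?_⟩
      · by_contra hk
        rw [h n (by omega)] at hn
        exact hk hn
      · by_contra hk
        exact absurd (hle n (by omega)) (by omega)
    refine ⟨Fin.equivSubtype.symm.permCongr (π.subtypePerm hlt), Equiv.ext fun n => ?_⟩
    by_cases hn : n < k
    · have := Equiv.Perm.extendDomain_apply_subtype
        (Fin.equivSubtype.symm.permCongr (π.subtypePerm hlt)) Fin.equivSubtype hn
      rw [embedPerm, this]
      simp [Equiv.permCongr_apply]
    · rw [h n (by omega), embedPerm]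
      exact Equiv.Perm.extendDomain_apply_not_subtype _ _ hn

lemma monotone_range_embedPerm : Monotone fun k => Set.range (embedPerm k) :=
  fun _ _ hij _ hπ => mem_range_embedPerm.2 fun n hn => mem_range_embedPerm.1 hπ n (hij.trans hn)

lemma iUnion_range_embedPerm :
    ⋃ k, Set.range (embedPerm k) = {π | FinitelySupported π} := by
  ext π
  simp only [Set.mem_iUnion, mem_range_embedPerm, Set.mem_ofPred_eq, FinitelySupported]
  constructor
  · rintro ⟨k, hk⟩
    refine (Set.finite_lt_nat k).subset fun n hn => ?_
    by_contra hkn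
    exact hn (hk n (not_lt.1 hkn))
  · intro hfin
    obtain ⟨b, hb⟩ := hfin.bddAbove
    refine ⟨b + 1, fun n hn => ?_⟩
    by_contra hne
    exact absurd (hb hne) (by omega)

end EmbedPerm

section EmpiricalMeasure

variable {ι X : Type*} [Fintype ι] [MeasurableSpace X]

/-- The uniform average of the Dirac masses at a finite family of points. -/
noncomputable def empiricalMeasure (p : ι → X) : Measure X :=
  (Fintype.card ι : ENNReal)⁻¹ • ∑ i, Measure.dirac (p i)

instance [Nonempty ι] (p : ι → X) : IsProbabilityMeasure (empiricalMeasure p) := ⟨by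
  simp [empiricalMeasure, ENNReal.inv_mul_cancel]⟩

lemma integral_empiricalMeasure (p : ι → X) {f : X → ℝ} (hf : StronglyMeasurable f) :
    ∫ x, f x ∂(empiricalMeasure p) = (∑ i, f (p i)) / (Fintype.card ι : ℝ) := by
  rw [empiricalMeasure, integral_smul_measure, integral_finsetSum_measure fun i _ =>
    integrable_dirac' hf (by simp)]
  simp [integral_dirac' f _ hf, div_eq_inv_mul]

end EmpiricalMeasure

/-- On a second-countable space, convergence on a suitable countable family of measurable sets
implies weak convergence of probability measures. -/
lemma exists_countable_forall_tendsto_probabilityMeasure (X : Type*) [TopologicalSpace X]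
    [SecondCountableTopology X] [MeasurableSpace X] [OpensMeasurableSpace X] :
    ∃ S : Set (Set X), S.Countable ∧ (∀ s ∈ S, MeasurableSet s) ∧
      ∀ (P : ℕ → ProbabilityMeasure X) (Q : ProbabilityMeasure X),
        (∀ s ∈ S, Tendsto (fun k => (P k : Measure X).real s) atTop
          (𝓝 ((Q : Measure X).real s))) →
        Tendsto P atTop (𝓝 Q) := by
  have hbasis := TopologicalSpace.isBasis_countableBasis X
  have hmeas : ∀ s ∈ generateSetAlgebra (TopologicalSpace.countableBasis X), MeasurableSet s :=
    fun s hs => by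
      induction hs with
      | base s hs => exact (hbasis.isOpen hs).measurableSet
      | empty => exact .empty
      | compl s _ ih => exact ih.compl
      | union s t _ _ ihs iht => exact ihs.union iht
  refine ⟨generateSetAlgebra (TopologicalSpace.countableBasis X),
    countable_generateSetAlgebra (TopologicalSpace.countable_countableBasis X), hmeas,
    fun P Q h => ?_⟩
  refine IsPiSystem.tendsto_probabilityMeasure_of_tendsto_of_mem
    (fun s hs t ht _ => isSetAlgebra_generateSetAlgebra.inter_mem hs ht) hmeas (fun u hu x hx => ?_)
    fun s hs => NNReal.tendsto_coe.1 (h s hs)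
  obtain ⟨v, hv, hxv, hvu⟩ := hbasis.exists_subset_of_mem_open hx hu
  exact ⟨v, self_subset_generateSetAlgebra hv, (hbasis.isOpen hv).mem_nhds hxv, hvu⟩

/-- **Ergodic decomposition together with the law of large numbers for exchangeable
random structures** (Corollary to `lemma:main`): for a measurable, measure-preserving
action `T` of the finitary symmetric group on a Polish space, there is a measurable
random ergodic measure `ξ` which is a version of the conditional probability given the
invariant σ-algebra, and for a.e. `x` the empirical measures
`(k!)⁻¹ ∑_{π ∈ S_k} δ_{T π x}` converge weakly to `ξ x`. -/
theorem exchangeable_empirical_measure_converges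
    {Xs : Type*} [TopologicalSpace Xs] [PolishSpace Xs] [MeasurableSpace Xs] [BorelSpace Xs]
    (μ : Measure Xs) [IsProbabilityMeasure μ]
    (T : Equiv.Perm ℕ → Xs → Xs)
    (hTmeas : ∀ π, Measurable (T π))
    (hTid : ∀ x, T 1 x = x)
    (hTcomp : ∀ π π' x, T (π * π') x = T π (T π' x))
    (hTinv : ∀ π, FinitelySupported π → Measure.map (T π) μ = μ) :
    ∃ ξ : Xs → Measure Xs,
      Measurable ξ ∧
      (∀ x, IsProbabilityMeasure (ξ x)) ∧
      (∀ A : Set Xs, MeasurableSet A →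
        (fun x => (ξ x A).toReal)
          =ᵐ[μ] μ[A.indicator (fun _ => (1 : ℝ)) | invSigmaOn {π | FinitelySupported π} T]) ∧
      (∀ᵐ x ∂μ, ∀ f : Xs →ᵇ ℝ,
        Tendsto
          (fun k => (∑ π : Equiv.Perm (Fin k), f (T (embedPerm k π) x)) / (Nat.factorial k : ℝ))
          atTop (𝓝 (∫ z, f z ∂(ξ x)))) := by
  have hmle := invSigmaOn_le {π | FinitelySupported π} T
  have hker : ∀ A : Set Xs, MeasurableSet A →
      (fun x => (ProbabilityTheory.condExpKernel μ
        (invSigmaOn {π | FinitelySupported π} T) x).real A) =ᵐ[μ]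
        μ[A.indicator (fun _ => (1 : ℝ)) | invSigmaOn {π | FinitelySupported π} T] := fun A hA =>
    ProbabilityTheory.condExpKernel_ae_eq_condExp hmle hA
  have := nonempty_of_isProbabilityMeasure μ
  refine ⟨fun x => ProbabilityTheory.condExpKernel μ (invSigmaOn {π | FinitelySupported π} T) x,
    (ProbabilityTheory.condExpKernel μ (invSigmaOn {π | FinitelySupported π} T)).measurable.mono
      hmle le_rfl, fun x => inferInstance, hker, ?_⟩
  let P : ℕ → Xs → Measure Xs :=
    fun k x => empiricalMeasure fun π : Equiv.Perm (Fin k) => T (embedPerm k π) x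
  have hP : ∀ k x, ∀ f : Xs → ℝ, StronglyMeasurable f → ∫ z, f z ∂(P k x) =
      (∑ π : Equiv.Perm (Fin k), f (T (embedPerm k π) x)) / (Nat.factorial k : ℝ) :=
    fun k x f hf => by
      simp only [P, integral_empiricalMeasure _ hf, Fintype.card_perm, Fintype.card_fin]
  have hfin : ∀ k π, FinitelySupported (embedPerm k π) := fun k π => by
    have hmem := Set.mem_iUnion_of_mem (s := fun k => Set.range (embedPerm k)) k
      (Set.mem_range_self π)
    rwa [iUnion_range_embedPerm] at hmem
  have hconv : ∀ A : Set Xs, MeasurableSet A → ∀ᵐ x ∂μ,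
      Tendsto (fun k => (P k x).real A) atTop
        (𝓝 ((ProbabilityTheory.condExpKernel μ
          (invSigmaOn {π | FinitelySupported π} T) x).real A)) := fun A hA => by
    have hind : StronglyMeasurable (A.indicator (1 : Xs → ℝ)) :=
      stronglyMeasurable_one.indicator hA
    have havg : ∀ᵐ x ∂μ, ∀ k, (P k x).real A =
        (μ[A.indicator (1 : Xs → ℝ) | invSigmaOn (Set.range (embedPerm k)) T]) x :=
      ae_all_iff.2 fun k => by
        filter_upwards [average_ae_eq_condExp_invSigmaOn_range
          (Equiv.Perm.extendDomainHom Fin.equivSubtype : Equiv.Perm (Fin k) →* Equiv.Perm ℕ)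
          (fun _ => hTmeas _) hTcomp (fun π => hTinv _ (hfin k π)) hind.measurable
          ((integrable_const 1).indicator hA)] with x hx
        rw [← integral_indicator_one hA, hP k x _ hind]
        rwa [Fintype.card_perm, Fintype.card_fin] at hx
    have hlevy := tendsto_ae_condExp_iInf (μ := μ)
      (m := fun k => invSigmaOn (Set.range (embedPerm k)) T)
      (fun i j hij => invSigmaOn_anti T (monotone_range_embedPerm hij))
      (fun k => invSigmaOn_le _ _) hind.aestronglyMeasurable (C := 1)
      (.of_forall fun x => by
        by_cases hx : x ∈ A <;> simp [hx])
    rw [iInf_invSigmaOn, iUnion_range_embedPerm] at hlevy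
    filter_upwards [hlevy, havg, hker A hA] with x hx hx' hx''
    simp only [hx', hx'']
    exact hx
  obtain ⟨S, hS, hSmeas, hStend⟩ := exists_countable_forall_tendsto_probabilityMeasure Xs
  filter_upwards [(ae_ball_iff hS).2 fun A hA => hconv A (hSmeas A hA)] with x hx f
  have hweak := hStend (fun k => ⟨P k x, by dsimp only [P]; infer_instance⟩)
    ⟨ProbabilityTheory.condExpKernel μ (invSigmaOn {π | FinitelySupported π} T) x, inferInstance⟩ hx
  have hf := ProbabilityMeasure.tendsto_iff_forall_integral_tendsto.1 hweak f
  simpa only [ProbabilityMeasure.coe_mk, hP _ x f f.continuous.stronglyMeasurable] using hf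
end
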